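/- Let G be a finite abelian group. Then EG(G) is planar if and only if |G| ≤ 4. -/

import Mathlib

open unitInterval

/-- A simple graph is planar if its vertices can be placed at distinct points
of the plane and its edges drawn as simple arcs joining their endpoints, such
that the interior of each arc avoids all vertices, and interiors of arcs of
distinct edges do not meet. -/
def IsPlanar {V : Type*} (G : SimpleGraph V) : Prop :=
  ∃ (pos : V → ℝ × ℝ) (γ : ∀ u v : V, G.Adj u v → Path (pos u) (pos v)),
    Function.Injective pos ∧
    (∀ u v (h : G.Adj u v), Function.Injective (γ u v h)) ∧
    (∀ u v (h : G.Adj u v) (t : I), t ≠ 0 → t ≠ 1 →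
      (γ u v h) t ∉ Set.range pos) ∧
    (∀ u v (h : G.Adj u v) (u' v' : V) (h' : G.Adj u' v'),
      s(u, v) ≠ s(u', v') →
      ∀ (t t' : I), t ≠ 0 → t ≠ 1 → t' ≠ 0 → t' ≠ 1 →
        (γ u v h) t ≠ (γ u' v' h') t')

lemma exists_log_lift_path (f : C(I, ℂ)) (hf : ∀ t, f t ≠ 0) :
    ∃ L : C(I, ℂ), ∀ t, Complex.exp (L t) = f t := by
  let γ : C(I, {z : ℂ // z ≠ 0}) := ⟨fun t => ⟨f t, hf t⟩, by fun_prop⟩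
  obtain ⟨L, hL, -⟩ := Complex.isCoveringMap_exp.exists_path_lifts γ (Complex.log (f 0))
    (Subtype.ext (Complex.exp_log (hf 0)).symm)
  exact ⟨L, fun t => congrArg Subtype.val (congrFun hL t)⟩

lemma exists_log_lift_square (f : C(I × I, ℂ)) (hf : ∀ t, f t ≠ 0) :
    ∃ L : C(I × I, ℂ), ∀ t, Complex.exp (L t) = f t := by
  let γ : C(I × I, {z : ℂ // z ≠ 0}) := ⟨fun t => ⟨f t, hf t⟩, by fun_prop⟩
  obtain ⟨L0, hL0⟩ := exists_log_lift_path ⟨fun t => f (0, t), by fun_prop⟩ (fun t => hf _)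
  have h0 : ∀ a, γ (0, a) = (⟨_, (L0 a).exp_ne_zero⟩ : {z : ℂ // z ≠ 0}) :=
    fun a => Subtype.ext (hL0 a).symm
  refine ⟨Complex.isCoveringMap_exp.liftHomotopy γ L0 h0, fun t => ?_⟩
  exact congrArg Subtype.val
    (congrFun (Complex.isCoveringMap_exp.liftHomotopy_lifts γ L0 h0) t)

/-- Two continuous logarithms of the same path have the same total increment. -/
lemma log_increment_unique (L M : I → ℂ) (hL : Continuous L) (hM : Continuous M)
    (h : ∀ t, Complex.exp (L t) = Complex.exp (M t)) : L 1 - L 0 = M 1 - M 0 := by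
  have key := Complex.isCoveringMap_exp.eq_of_comp_eq (g₁ := L)
    (g₂ := fun t => M t + (L 0 - M 0)) hL (by fun_prop) (by
      funext t
      apply Subtype.ext
      have : Complex.exp (L 0 - M 0) = 1 := by
        rw [Complex.exp_sub, h 0, div_self (Complex.exp_ne_zero _)]
      simp [Complex.exp_add, this, h t]) 0 (by ring)
  have := congrFun key 1
  rw [this]; ring

/-- Integer relation for a pair of disjoint arcs. -/
lemma square_relation (pa pb pc pd : ℂ) (p q : C(I, ℂ)) (hp0 : p 0 = pa) (hp1 : p 1 = pb)
    (hq0 : q 0 = pc) (hq1 : q 1 = pd) (hne : ∀ s t, p s ≠ q t)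
    (La Lb Lc Ld : C(I, ℂ))
    (ha : ∀ t, Complex.exp (La t) = q t - pa) (hb : ∀ t, Complex.exp (Lb t) = q t - pb)
    (hc : ∀ t, Complex.exp (Lc t) = p t - pc) (hd : ∀ t, Complex.exp (Ld t) = p t - pd) :
    (La 1 - La 0) + (Ld 1 - Ld 0) = (Lb 1 - Lb 0) + (Lc 1 - Lc 0) := by
  obtain ⟨T, hT⟩ := exists_log_lift_square ⟨fun x => q x.2 - p x.1, by fun_prop⟩
    (fun x => sub_ne_zero.2 (hne _ _).symm)
  simp only [ContinuousMap.coe_mk] at hT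
  have h1 := log_increment_unique La (fun t => T (0, t)) (by fun_prop) (by fun_prop)
    (fun t => by simp [ha, hT, hp0])
  have h2 := log_increment_unique Lb (fun t => T (1, t)) (by fun_prop) (by fun_prop)
    (fun t => by simp [hb, hT, hp1])
  have h3 := log_increment_unique Lc (fun s => T (s, 0) + Real.pi * Complex.I)
    (by fun_prop) (by fun_prop)
    (fun t => by simp [hc, hT, hq0, Complex.exp_add])
  have h4 := log_increment_unique Ld (fun s => T (s, 1) + Real.pi * Complex.I)
    (by fun_prop) (by fun_prop)
    (fun t => by simp [hd, hT, hq1, Complex.exp_add])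
  rw [h1, h2, h3, h4]; ring

/-- The complete graph on five vertices cannot be drawn, even if only
non-adjacent edges are required to have disjoint arcs. -/
lemma no_K5_drawing (pos : Fin 5 → ℂ) (g : Fin 5 → Fin 5 → C(I, ℂ))
    (hinj : Function.Injective pos)
    (h0 : ∀ u v, u < v → g u v 0 = pos u) (h1 : ∀ u v, u < v → g u v 1 = pos v)
    (hv : ∀ u v w, u < v → w ≠ u → w ≠ v → ∀ t, g u v t ≠ pos w)
    (hd : ∀ a b c d, a < b → c < d → a ≠ c → a ≠ d → b ≠ c → b ≠ d →
      ∀ s t, g a b s ≠ g c d t) : False := by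
  -- angle of the vector from `u` to `v`
  obtain ⟨A, hA, hA'⟩ : ∃ A : Fin 5 → Fin 5 → ℂ,
      (∀ u v, u ≠ v → Complex.exp (A u v) = pos v - pos u) ∧
      ∀ u v, u < v → A v u = A u v + Real.pi * Complex.I := by
    refine ⟨fun u v => if u < v then Complex.log (pos v - pos u) else
      Complex.log (pos u - pos v) + Real.pi * Complex.I, ?_, ?_⟩
    · intro u v huv
      dsimp only
      split_ifs with h
      · rw [Complex.exp_log (sub_ne_zero.2 (hinj.ne huv.symm))]
      · rw [Complex.exp_add, Complex.exp_log (sub_ne_zero.2 (hinj.ne huv))]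
        simp
    · intro u v huv
      simp [huv, huv.not_gt]
  have hL : ∀ w u v, ∃ L : C(I, ℂ), u < v → w ≠ u → w ≠ v →
      ∀ t, Complex.exp (L t) = g u v t - pos w := by
    intro w u v
    by_cases h : u < v ∧ w ≠ u ∧ w ≠ v
    · obtain ⟨L, hL⟩ := exists_log_lift_path ⟨fun t => g u v t - pos w, by fun_prop⟩
        (fun t => sub_ne_zero.2 (hv u v w h.1 h.2.1 h.2.2 t))
      exact ⟨L, fun _ _ _ t => hL t⟩
    · exact ⟨0, fun a b c => absurd ⟨a, b, c⟩ h⟩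
  choose L hL using hL
  have hn : ∀ w u v, ∃ n : ℤ, u < v → w ≠ u → w ≠ v →
      L w u v 1 - L w u v 0 = A w v - A w u + n * (2 * Real.pi * Complex.I) := by
    intro w u v
    by_cases h : u < v ∧ w ≠ u ∧ w ≠ v
    · obtain ⟨x, y, z⟩ := h
      have e1 := hL w u v x y z 1
      have e0 := hL w u v x y z 0
      rw [h1 u v x, ← hA w v z, Complex.exp_eq_exp_iff_exists_int] at e1
      rw [h0 u v x, ← hA w u y, Complex.exp_eq_exp_iff_exists_int] at e0
      obtain ⟨n1, e1⟩ := e1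
      obtain ⟨n0, e0⟩ := e0
      refine ⟨n1 - n0, fun _ _ _ => ?_⟩
      rw [e1, e0]; push_cast; ring
    · exact ⟨0, fun a b c => absurd ⟨a, b, c⟩ h⟩
  choose n hn using hn
  let ε : Fin 5 → Fin 5 → ℤ := fun u v => if u < v then -1 else 1
  have hε : ∀ u v, u ≠ v → A u v - A v u = ε u v * (Real.pi * Complex.I) := by
    intro u v huv
    rcases lt_or_gt_of_ne huv with h | h
    · simp [ε, h, hA' u v h]
    · simp [ε, h.not_gt, hA' v u h]
  have key : ∀ a b c d, a < b → c < d → a ≠ c → a ≠ d → b ≠ c → b ≠ d →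
      2 * (n a c d + n d a b - n b c d - n c a b) +
        (ε a d + ε c a + ε d b + ε b c) = 0 := by
    intro a b c d hab hcd hac had hbc hbd
    have := square_relation (pos a) (pos b) (pos c) (pos d) (g a b) (g c d)
      (h0 _ _ hab) (h1 _ _ hab) (h0 _ _ hcd) (h1 _ _ hcd)
      (hd a b c d hab hcd hac had hbc hbd) (L a c d) (L b c d) (L c a b) (L d a b)
      (hL _ _ _ hcd hac had) (hL _ _ _ hcd hbc hbd)
      (hL _ _ _ hab hac.symm hbc.symm) (hL _ _ _ hab had.symm hbd.symm)
    rw [hn _ _ _ hcd hac had, hn _ _ _ hcd hbc hbd, hn _ _ _ hab hac.symm hbc.symm,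
      hn _ _ _ hab had.symm hbd.symm] at this
    have e1 := hε a d had
    have e2 := hε c a hac.symm
    have e3 := hε d b hbd.symm
    have e4 := hε b c hbc
    have hpi : (Real.pi * Complex.I : ℂ) ≠ 0 := by simp [Real.pi_ne_zero]
    have : (((2 * (n a c d + n d a b - n b c d - n c a b) +
        (ε a d + ε c a + ε d b + ε b c) : ℤ)) : ℂ) * (Real.pi * Complex.I) = 0 := by
      push_cast
      linear_combination this - e1 - e2 - e3 - e4
    exact_mod_cast (mul_eq_zero.1 this).resolve_right hpi
  have k1 := key 0 1 2 3 (by decide) (by decide) (by decide) (by decide) (by decide) (by decide)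
  have k2 := key 0 2 1 3 (by decide) (by decide) (by decide) (by decide) (by decide) (by decide)
  have k3 := key 0 3 1 2 (by decide) (by decide) (by decide) (by decide) (by decide) (by decide)
  have k4 := key 0 1 2 4 (by decide) (by decide) (by decide) (by decide) (by decide) (by decide)
  have k5 := key 0 2 1 4 (by decide) (by decide) (by decide) (by decide) (by decide) (by decide)
  have k6 := key 0 4 1 2 (by decide) (by decide) (by decide) (by decide) (by decide) (by decide)
  have k7 := key 0 1 3 4 (by decide) (by decide) (by decide) (by decide) (by decide) (by decide)
  have k8 := key 0 3 1 4 (by decide) (by decide) (by decide) (by decide) (by decide) (by decide)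
  have k9 := key 0 4 1 3 (by decide) (by decide) (by decide) (by decide) (by decide) (by decide)
  have k10 := key 0 2 3 4 (by decide) (by decide) (by decide) (by decide) (by decide) (by decide)
  have k11 := key 0 3 2 4 (by decide) (by decide) (by decide) (by decide) (by decide) (by decide)
  have k12 := key 0 4 2 3 (by decide) (by decide) (by decide) (by decide) (by decide) (by decide)
  have k13 := key 1 2 3 4 (by decide) (by decide) (by decide) (by decide) (by decide) (by decide)
  have k14 := key 1 3 2 4 (by decide) (by decide) (by decide) (by decide) (by decide) (by decide)
  have k15 := key 1 4 2 3 (by decide) (by decide) (by decide) (by decide) (by decide) (by decide)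
  simp [ε] at k1 k2 k3 k4 k5 k6 k7 k8 k9 k10 k11 k12 k13 k14 k15
  omega

lemma not_isPlanar_of_five {V : Type*} (G : SimpleGraph V) (φ : Fin 5 → V)
    (hφ : Function.Injective φ) (hadj : ∀ i j, i ≠ j → G.Adj (φ i) (φ j)) : ¬ IsPlanar G := by
  rintro ⟨pos, γ, hpos, -, hint, hdis⟩
  let e : ℝ × ℝ → ℂ := Complex.equivRealProdCLM.symm
  have he : Continuous e := Complex.equivRealProdCLM.symm.continuous
  have hei : Function.Injective e := Complex.equivRealProdCLM.symm.injective
  let g : Fin 5 → Fin 5 → C(I, ℂ) := fun i j => if h : i ≠ j then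
    ⟨fun t => e (γ _ _ (hadj i j h) t), he.comp (γ _ _ (hadj i j h)).continuous⟩ else 0
  have hg : ∀ i j (h : i ≠ j) t, g i j t = e (γ _ _ (hadj i j h) t) := by
    intro i j h t
    simp [g, h]
  have hvert : ∀ i j (h : i ≠ j) k, k ≠ i → k ≠ j → ∀ t,
      γ _ _ (hadj i j h) t ≠ pos (φ k) := by
    intro i j h k hki hkj t
    by_cases t0 : t = 0
    · subst t0; rw [Path.source]; exact fun h => hki (hφ (hpos h)).symm
    by_cases t1 : t = 1
    · subst t1; rw [Path.target]; exact fun h => hkj (hφ (hpos h)).symm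
    exact fun h' => hint _ _ _ t t0 t1 ⟨_, h'.symm⟩
  refine no_K5_drawing (fun i => e (pos (φ i))) g (hei.comp (hpos.comp hφ)) ?_ ?_ ?_ ?_
  · intro u v h; rw [hg u v h.ne, Path.source]
  · intro u v h; rw [hg u v h.ne, Path.target]
  · intro u v w h hu hv t
    rw [hg u v h.ne]
    exact hei.ne (hvert u v h.ne w hu hv t)
  · intro a b c d hab hcd hac had hbc hbd s t
    rw [hg a b hab.ne, hg c d hcd.ne]
    apply hei.ne
    by_cases s0 : s = 0
    · subst s0; rw [Path.source]; exact (hvert c d hcd.ne a hac had t).symm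
    by_cases s1 : s = 1
    · subst s1; rw [Path.target]; exact (hvert c d hcd.ne b hbc hbd t).symm
    by_cases t0 : t = 0
    · subst t0; rw [Path.source]; exact hvert a b hab.ne c hac.symm hbc.symm s
    by_cases t1 : t = 1
    · subst t1; rw [Path.target]; exact hvert a b hab.ne d had.symm hbd.symm s
    refine hdis _ _ _ _ _ _ ?_ s t s0 s1 t0 t1
    simp [hφ.eq_iff, hac, had]

/-- An element whose order is the exponent can be mapped to any other element. -/
lemma exists_end_of_orderOf_eq_exponent {G : Type*} [CommGroup G] [Finite G] (a y : G)
    (ha : orderOf a = Monoid.exponent G) : ∃ f : Monoid.End G, f a = y := by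
  have hne : Monoid.exponent G ≠ 0 := Monoid.exponent_ne_zero_of_finite
  have : NeZero (Monoid.exponent G) := ⟨hne⟩
  have : NeZero ((Monoid.exponent G : ℕ) : ℂ) := ⟨by exact_mod_cast hne⟩
  obtain ⟨z, hz⟩ := HasEnoughRootsOfUnity.exists_primitiveRoot ℂ (Monoid.exponent G)
  have hu := hz.isUnit_unit hne
  set ζ : ℂˣ := (hz.isUnit hne).unit with hζ
  have hgen : ∀ x : Subgroup.zpowers a, x ∈ Subgroup.zpowers
      (⟨a, Subgroup.mem_zpowers a⟩ : Subgroup.zpowers a) := by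
    rintro ⟨x, k, rfl⟩
    exact ⟨k, by ext; simp⟩
  have hord : orderOf ζ = Monoid.exponent G := hu.eq_orderOf.symm
  obtain ⟨φ, hφ⟩ := MonoidHom.domRestrict_surjective ℂ (Subgroup.zpowers a)
    (monoidHomOfForallMemZpowers hgen (g' := ζ) (by simp [hord, ha]))
  have hφa : φ a = ζ := by
    have := DFunLike.congr_fun hφ ⟨a, Subgroup.mem_zpowers a⟩
    rw [monoidHomOfForallMemZpowers_apply_gen] at this
    exact this
  have hmem : ∀ g, φ g ∈ Subgroup.zpowers ζ := by
    intro g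
    rw [hu.zpowers_eq, mem_rootsOfUnity, ← map_pow, Monoid.pow_exponent_eq_one, map_one]
  have hgen2 : ∀ x : Subgroup.zpowers ζ, x ∈ Subgroup.zpowers
      (⟨ζ, Subgroup.mem_zpowers ζ⟩ : Subgroup.zpowers ζ) := by
    rintro ⟨x, k, rfl⟩
    exact ⟨k, by ext; simp⟩
  have hdvd : orderOf y ∣ orderOf (⟨ζ, Subgroup.mem_zpowers ζ⟩ : Subgroup.zpowers ζ) := by
    simpa [hord] using Monoid.order_dvd_exponent y
  refine ⟨(monoidHomOfForallMemZpowers hgen2 hdvd).comp (φ.codRestrict _ hmem), ?_⟩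
  have : φ.codRestrict _ hmem a = ⟨ζ, Subgroup.mem_zpowers ζ⟩ := Subtype.ext hφa
  change monoidHomOfForallMemZpowers hgen2 hdvd (φ.codRestrict _ hmem a) = y
  rw [this, monoidHomOfForallMemZpowers_apply_gen]

/-- A five-element family of the form `1, a, a⁻¹, b, b⁻¹`. -/
lemma five_family {G : Type*} [CommGroup G] (R : SimpleGraph G) (a b : G)
    (ha : a * a ≠ 1) (hb : b * b ≠ 1) (hab : a ≠ b) (hab' : a * b ≠ 1)
    (h1 : ∀ x : G, x ≠ 1 → R.Adj x 1) (hinv : ∀ x : G, x ≠ x⁻¹ → R.Adj x x⁻¹)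
    (r1 : R.Adj a b) (r2 : R.Adj a b⁻¹) (r3 : R.Adj a⁻¹ b) (r4 : R.Adj a⁻¹ b⁻¹) :
    ∃ φ : Fin 5 → G, Function.Injective φ ∧ ∀ i j, i ≠ j → R.Adj (φ i) (φ j) := by
  have a1 : a ≠ 1 := by rintro rfl; simp at ha
  have b1 : b ≠ 1 := by rintro rfl; simp at hb
  have a2 := h1 a a1
  have a3 := h1 b b1
  have a4 := h1 a⁻¹ (by simpa using a1)
  have a5 := h1 b⁻¹ (by simpa using b1)
  have a6 := hinv a (fun h => ha (by nth_rewrite 2 [h]; simp))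
  have a7 := hinv b (fun h => hb (by nth_rewrite 2 [h]; simp))
  have main : ∀ i j, i ≠ j → R.Adj (![1, a, a⁻¹, b, b⁻¹] i) (![1, a, a⁻¹, b, b⁻¹] j) := by
    have hlt : ∀ i j, i < j → R.Adj (![1, a, a⁻¹, b, b⁻¹] i) (![1, a, a⁻¹, b, b⁻¹] j) := by
      intro i j hij
      fin_cases i <;> fin_cases j <;>
        first
        | exact absurd hij (by decide)
        | assumption
        | (apply SimpleGraph.Adj.symm; assumption)
    intro i j hij
    rcases lt_or_gt_of_ne hij with h | h
    · exact hlt i j h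
    · exact (hlt j i h).symm
  refine ⟨_, fun i j h => ?_, main⟩
  by_contra hij
  exact (main i j hij).ne h

lemma exists_five {G : Type*} [CommGroup G] [Fintype G] (hG : 4 < Fintype.card G) :
    ∃ φ : Fin 5 → G, Function.Injective φ ∧ ∀ i j, i ≠ j →
      (SimpleGraph.fromRel (fun x y : G => ∃ f : Monoid.End G, f x = y)).Adj (φ i) (φ j) := by
  have hpow : ∀ (x : G) (k : ℤ), ∃ f : Monoid.End G, f x = x ^ k :=
    fun x k => ⟨zpowGroupHom k, rfl⟩
  have h1 : ∀ x : G, x ≠ 1 →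
      (SimpleGraph.fromRel (fun x y : G => ∃ f : Monoid.End G, f x = y)).Adj x 1 :=
    fun x hx => ⟨hx, Or.inl (by simpa using hpow x 0)⟩
  have hinv : ∀ x : G, x ≠ x⁻¹ →
      (SimpleGraph.fromRel (fun x y : G => ∃ f : Monoid.End G, f x = y)).Adj x x⁻¹ :=
    fun x hx => ⟨hx, Or.inl (by simpa using hpow x (-1))⟩
  obtain ⟨a, ha⟩ := Monoid.exists_orderOf_eq_exponent (G := G)
    (Monoid.ExponentExists.of_finite)
  have hpos : 0 < orderOf a := orderOf_pos a
  have hnot : ∀ k, 0 < k → k < orderOf a → a ^ k ≠ 1 :=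
    fun k h0 hk => pow_ne_one_of_lt_orderOf h0.ne' hk
  by_cases h5 : 5 ≤ orderOf a
  · have e1 : a ≠ 1 := by simpa using hnot 1 (by omega) (by omega)
    have e2 := hnot 2 (by omega) (by omega)
    have e3 := hnot 3 (by omega) (by omega)
    have e4 := hnot 4 (by omega) (by omega)
    have i1 : a ≠ a ^ 2 := fun h => e1 (by
      have : a * 1 = a * a := by rw [mul_one, ← pow_two]; exact h
      exact (mul_left_cancel this).symm)
    have i2 : a * a ^ 2 ≠ 1 := by rw [← pow_succ']; exact e3
    refine five_family _ a (a ^ 2) (by rwa [← pow_two]) (by rwa [← pow_add]) i1 i2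
      h1 hinv ⟨i1, Or.inl ⟨powMonoidHom 2, rfl⟩⟩ ⟨?_, Or.inl ?_⟩ ⟨?_, Or.inl ?_⟩ ⟨?_, Or.inl ?_⟩
    · exact fun h => i2 (mul_eq_one_iff_eq_inv.2 h)
    · obtain ⟨f, hf⟩ := hpow a (-2)
      exact ⟨f, by rw [hf, zpow_neg, zpow_ofNat]⟩
    · exact fun h => i2 (by rw [← h]; simp)
    · obtain ⟨f, hf⟩ := hpow a⁻¹ (-2)
      exact ⟨f, by rw [hf, inv_zpow, zpow_neg, inv_inv, zpow_ofNat]⟩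
    · exact fun h => i1 (inv_injective h)
    · obtain ⟨f, hf⟩ := hpow a⁻¹ 2
      exact ⟨f, by rw [hf, inv_zpow, zpow_ofNat]⟩
  have hmax : ∀ x y : G, orderOf x = orderOf a → x ≠ y →
      (SimpleGraph.fromRel (fun x y : G => ∃ f : Monoid.End G, f x = y)).Adj x y :=
    fun x y hx hxy => ⟨hxy, Or.inl (exists_end_of_orderOf_eq_exponent x y (hx.trans ha))⟩
  have hdvd : ∀ x : G, orderOf x ∣ orderOf a := fun x => ha ▸ Monoid.order_dvd_exponent x
  by_cases h4 : orderOf a = 4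
  · have hord : ∀ x : G, x * x ≠ 1 → orderOf x = orderOf a := by
      intro x hx
      have h2 : ¬ orderOf x ∣ 2 := fun h => hx (by
        rw [← pow_two]; exact orderOf_dvd_iff_pow_eq_one.1 h)
      have h := hdvd x
      rw [h4] at h ⊢
      have : orderOf x ≤ 4 := Nat.le_of_dvd (by norm_num) h
      interval_cases orderOf x <;> revert h h2 <;> decide
    have ha2 : a * a ≠ 1 := by rw [← pow_two]; exact hnot 2 (by omega) (by omega)
    obtain ⟨b, hb⟩ : ∃ b, b ∉ Subgroup.zpowers a := by
      by_contra! hall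
      have := orderOf_eq_card_of_forall_mem_zpowers hall
      rw [Nat.card_eq_fintype_card] at this
      omega
    obtain ⟨c, hc, hc2⟩ : ∃ c, c ∉ Subgroup.zpowers a ∧ c * c ≠ 1 := by
      by_cases hbb : b * b = 1
      · refine ⟨a * b, ?_, ?_⟩
        · rwa [Subgroup.mul_mem_cancel_left _ (Subgroup.mem_zpowers a)]
        · rwa [mul_mul_mul_comm, hbb, mul_one]
      · exact ⟨b, hb, hbb⟩
    have i1 : a ≠ c := by rintro rfl; exact hc (Subgroup.mem_zpowers a)
    have i2 : a * c ≠ 1 := fun h => hc (by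
      rw [← inv_eq_of_mul_eq_one_right h]; exact inv_mem (Subgroup.mem_zpowers a))
    exact five_family _ a c ha2 hc2 i1 i2 h1 hinv
      (hmax _ _ rfl i1) (hmax _ _ rfl fun h => i2 (mul_eq_one_iff_eq_inv.2 h))
      (hmax _ _ (orderOf_inv a) fun h => i2 (by rw [← h]; simp))
      (hmax _ _ (orderOf_inv a) fun h => i1 (inv_injective h))
  · have hord : ∀ x : G, x ≠ 1 → orderOf x = orderOf a := by
      intro x hx
      have h := hdvd x
      have h' : orderOf x ≠ 1 := fun h => hx (orderOf_eq_one_iff.1 h)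
      have : orderOf a ≤ 3 := by omega
      have : orderOf x ≤ orderOf a := Nat.le_of_dvd hpos h
      generalize orderOf a = m at *
      generalize orderOf x = k at *
      interval_cases m <;> interval_cases k <;> first | rfl | (exfalso; revert h h'; decide)
    obtain ⟨φ⟩ : Nonempty (Fin 5 ↪ G) := Function.Embedding.nonempty_of_card_le (by simpa)
    refine ⟨φ, φ.injective, fun i j hij => ?_⟩
    have hne := φ.injective.ne hij
    by_cases hi : φ i = 1
    · have : φ j ≠ 1 := fun h => hne (hi.trans h.symm)
      rw [hi]
      exact (h1 _ this).symm
    · exact hmax _ _ (hord _ hi) hne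

/-- Four points in the plane, no three collinear, the last in the triangle of the others. -/
def fourX : Fin 4 → ℝ := ![0, 4, 0, 1]

/-- Second coordinates of the four points. -/
def fourY : Fin 4 → ℝ := ![0, 0, 4, 1]

lemma four_vertex (u v w : Fin 4) (huv : u ≠ v) (t : ℝ) (h0 : 0 < t) (h1 : t < 1)
    (hx : (1 - t) * fourX u + t * fourX v = fourX w)
    (hy : (1 - t) * fourY u + t * fourY v = fourY w) : False := by
  fin_cases u <;> fin_cases v <;> first | exact huv rfl | skip
  all_goals fin_cases w <;> simp [fourX, fourY] at hx hy <;> linarith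

lemma four_edge (u v u' v' : Fin 4) (huv : u ≠ v) (huv' : u' ≠ v') (hne : s(u, v) ≠ s(u', v'))
    (t s : ℝ) (h0 : 0 < t) (h1 : t < 1) (h2 : 0 < s) (h3 : s < 1)
    (hx : (1 - t) * fourX u + t * fourX v = (1 - s) * fourX u' + s * fourX v')
    (hy : (1 - t) * fourY u + t * fourY v = (1 - s) * fourY u' + s * fourY v') : False := by
  fin_cases u <;> fin_cases v <;> first | exact huv rfl | skip
  all_goals
    fin_cases u' <;> fin_cases v' <;>
    first
    | exact huv' rfl
    | exact hne (by decide)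
    | (simp [fourX, fourY] at hx hy <;> linarith)

lemma isPlanar_of_card_le_four {V : Type*} [Fintype V] (G : SimpleGraph V)
    (h : Fintype.card V ≤ 4) : IsPlanar G := by
  obtain ⟨ι⟩ : Nonempty (V ↪ Fin 4) := Function.Embedding.nonempty_of_card_le (by simpa)
  let pos : V → ℝ × ℝ := fun v => (fourX (ι v), fourY (ι v))
  let γ : ∀ u v : V, Path (pos u) (pos v) := fun u v =>
    { toFun := fun t => ((1 - (t : ℝ)) * fourX (ι u) + t * fourX (ι v),
        (1 - (t : ℝ)) * fourY (ι u) + t * fourY (ι v))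
      continuous_toFun := by fun_prop
      source' := by simp [pos]
      target' := by simp [pos] }
  have hγ : ∀ u v t, γ u v t = ((1 - (t : ℝ)) * fourX (ι u) + t * fourX (ι v),
        (1 - (t : ℝ)) * fourY (ι u) + t * fourY (ι v)) := fun _ _ _ => rfl
  have hpt : ∀ i j : Fin 4, fourX i = fourX j → fourY i = fourY j → i = j := by
    intro i j hx hy
    fin_cases i <;> fin_cases j <;> first | rfl | (simp [fourX, fourY] at hx hy)
  have hI : ∀ t : I, t ≠ 0 → t ≠ 1 → 0 < (t : ℝ) ∧ (t : ℝ) < 1 := fun t a b =>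
    ⟨unitInterval.pos_iff_ne_zero.2 a, unitInterval.lt_one_iff_ne_one.2 b⟩
  refine ⟨pos, fun u v _ => γ u v, ?_, ?_, ?_, ?_⟩
  · intro u v huv
    obtain ⟨hx, hy⟩ := Prod.mk.inj huv
    exact ι.injective (hpt _ _ hx hy)
  · intro u v huv s t hst
    dsimp only at hst
    rw [hγ, hγ] at hst
    obtain ⟨hx, hy⟩ := Prod.mk.inj hst
    by_contra hne
    have hne' : (s : ℝ) - t ≠ 0 := sub_ne_zero.2 fun h => hne (Subtype.ext h)
    refine huv.ne (ι.injective (hpt _ _ ?_ ?_))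
    · have : ((s : ℝ) - t) * (fourX (ι v) - fourX (ι u)) = 0 := by linear_combination hx
      exact (sub_eq_zero.1 ((mul_eq_zero.1 this).resolve_left hne')).symm
    · have : ((s : ℝ) - t) * (fourY (ι v) - fourY (ι u)) = 0 := by linear_combination hy
      exact (sub_eq_zero.1 ((mul_eq_zero.1 this).resolve_left hne')).symm
  · rintro u v huv t t0 t1 ⟨w, hw⟩
    rw [hγ] at hw
    obtain ⟨hx, hy⟩ := Prod.mk.inj hw
    exact four_vertex _ _ _ (ι.injective.ne huv.ne) t (hI t t0 t1).1 (hI t t0 t1).2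
      hx.symm hy.symm
  · intro u v huv u' v' huv' hne t s t0 t1 s0 s1 heq
    rw [hγ, hγ] at heq
    obtain ⟨hx, hy⟩ := Prod.mk.inj heq
    refine four_edge _ _ _ _ (ι.injective.ne huv.ne) (ι.injective.ne huv'.ne) ?_ t s
      (hI t t0 t1).1 (hI t t0 t1).2 (hI s s0 s1).1 (hI s s0 s1).2 hx hy
    intro h
    exact hne (Sym2.map.injective ι.injective (by simpa using h))

/-- The endomorphism graph of a finite abelian group is planar iff the group
has at most `4` elements. -/
theorem abelian_endomorphism_graph_planar_iff {G : Type*} [CommGroup G]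
    [Fintype G] :
    IsPlanar (SimpleGraph.fromRel (fun x y : G => ∃ f : Monoid.End G, f x = y))
      ↔ Fintype.card G ≤ 4 := by
  constructor
  · intro h
    by_contra hcard
    obtain ⟨φ, hφ, hadj⟩ := exists_five (G := G) (not_le.1 hcard)
    exact not_isPlanar_of_five _ φ hφ hadj h
  · exact isPlanar_of_card_le_four _
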